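/- Every uplifting cardinal κ is Σ₃-reflecting: for every Σ₃ formula φ(x) in the language of set theory and every a ∈ V_κ, φ(a) holds in the universe of sets if and only if V_κ ⊨ φ(a). -/

import Mathlib

open FirstOrder Language

universe u

namespace Paper

/-- The language of set theory: a single binary relation symbol (membership).
We reuse `FirstOrder.Language.graph`, whose sole symbol is a binary relation. -/
abbrev LSet : FirstOrder.Language := FirstOrder.Language.graph

/-- The rank-initial segment `V_α` of the cumulative hierarchy, realized as the
collection of ZF sets of rank less than `α`. -/
abbrev Vt (α : Ordinal) : Type 1 := {x : ZFSet // x.rank < α}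

/-- `V_α` as a structure in the language of set theory, with the membership relation. -/
instance VtStructure (α : Ordinal) : LSet.Structure (Vt α) where
  funMap := fun f _ => f.elim
  RelMap := fun r x => match r with | .adj => (x 0).1 ∈ (x 1).1

/-- The universe of sets as a structure in the language of set theory. -/
instance ZFSetStructure : LSet.Structure ZFSet where
  funMap := fun f _ => f.elim
  RelMap := fun r x => match r with | .adj => x 0 ∈ x 1

/-- `V_α ≺ V_β`: the inclusion of `V_α` into `V_β` is an elementary embedding. -/
def VElem (α β : Ordinal) : Prop :=
  ∃ e : Vt α ↪ₑ[LSet] Vt β, ∀ x : Vt α, (e x : ZFSet) = x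

/-- An ordinal which is a cardinal. -/
def IsCardOrd (γ : Ordinal) : Prop := γ.card.ord = γ

/-- An ordinal which is a regular cardinal. -/
def IsRegularOrd (γ : Ordinal) : Prop := γ.card.IsRegular ∧ γ.card.ord = γ

/-- An ordinal which is an inaccessible cardinal (uncountable, regular, strong limit). -/
def IsInaccOrd (γ : Ordinal) : Prop := γ.card.IsInaccessible ∧ γ.card.ord = γ

/-- An inaccessible cardinal `κ` is uplifting if for every ordinal `θ` there is an
inaccessible cardinal `γ ≥ θ` such that `V_κ ≺ V_γ` is a proper elementary extension. -/
def IsUplifting (κ : Ordinal) : Prop :=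
  IsInaccOrd κ ∧ ∀ θ : Ordinal, ∃ γ : Ordinal, IsInaccOrd γ ∧ θ ≤ γ ∧ κ < γ ∧ VElem κ γ

/-- An inaccessible cardinal `κ` is pseudo uplifting if for every ordinal `θ` there is a
cardinal `γ ≥ θ` such that `V_κ ≺ V_γ` is a proper elementary extension. -/
def IsPseudoUplifting (κ : Ordinal) : Prop :=
  IsInaccOrd κ ∧ ∀ θ : Ordinal, ∃ γ : Ordinal, IsCardOrd γ ∧ θ ≤ γ ∧ κ < γ ∧ VElem κ γ

/-- The membership formula `t₁ ∈ t₂` between two terms. -/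
def memBF {α : Type} {n : ℕ} (t₁ t₂ : LSet.Term (α ⊕ Fin n)) : LSet.BoundedFormula α n :=
  Language.adj.boundedFormula₂ t₁ t₂

/-- A formula of the language of set theory all of whose quantifiers are bounded
(of the form `∀ x ∈ t` or `∃ x ∈ t`): the Δ₀ formulas. -/
inductive IsDelta0 : ∀ {α : Type} {n : ℕ}, LSet.BoundedFormula α n → Prop
  | of_isQF {α n} {φ : LSet.BoundedFormula α n} : φ.IsQF → IsDelta0 φ
  | imp {α n} {φ ψ : LSet.BoundedFormula α n} :
      IsDelta0 φ → IsDelta0 ψ → IsDelta0 (φ.imp ψ)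
  | ball {α n} (t : LSet.Term (α ⊕ Fin n)) {φ : LSet.BoundedFormula α (n + 1)} :
      IsDelta0 φ →
      IsDelta0 ((memBF (Term.var (Sum.inr (Fin.last n)))
        (t.relabel (Sum.map id Fin.castSucc)) ⟹ φ).all)
  | bex {α n} (t : LSet.Term (α ⊕ Fin n)) {φ : LSet.BoundedFormula α (n + 1)} :
      IsDelta0 φ →
      IsDelta0 ((memBF (Term.var (Sum.inr (Fin.last n)))
        (t.relabel (Sum.map id Fin.castSucc)) ⊓ φ).ex)

mutual
  /-- Σₖ formulas: `k` alternating blocks of quantifiers beginning with an existential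
  block, followed by a Δ₀ formula (degenerate blocks allowed). -/
  inductive IsSigmaFml : ℕ → ∀ {α : Type} {n : ℕ}, LSet.BoundedFormula α n → Prop
    | of_delta0 {k : ℕ} {α n} {φ : LSet.BoundedFormula α n} : IsDelta0 φ → IsSigmaFml k φ
    | of_pi {k : ℕ} {α n} {φ : LSet.BoundedFormula α n} : IsPiFml k φ → IsSigmaFml (k + 1) φ
    | ex {k : ℕ} {α n} {φ : LSet.BoundedFormula α (n + 1)} :
        IsSigmaFml (k + 1) φ → IsSigmaFml (k + 1) φ.ex
  /-- Πₖ formulas: `k` alternating blocks of quantifiers beginning with a universal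
  block, followed by a Δ₀ formula (degenerate blocks allowed). -/
  inductive IsPiFml : ℕ → ∀ {α : Type} {n : ℕ}, LSet.BoundedFormula α n → Prop
    | of_delta0 {k : ℕ} {α n} {φ : LSet.BoundedFormula α n} : IsDelta0 φ → IsPiFml k φ
    | of_sigma {k : ℕ} {α n} {φ : LSet.BoundedFormula α n} : IsSigmaFml k φ → IsPiFml (k + 1) φ
    | all {k : ℕ} {α n} {φ : LSet.BoundedFormula α (n + 1)} :
        IsPiFml (k + 1) φ → IsPiFml (k + 1) φ.all
end

/-- An inaccessible cardinal `κ` is Σₖ-reflecting if for every Σₖ formula `φ(x)` and every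
`a ∈ V_κ`, `φ(a)` holds in the universe of sets if and only if `V_κ ⊨ φ(a)`. -/
def SigmaReflecting (k : ℕ) (κ : Ordinal) : Prop :=
  IsInaccOrd κ ∧ ∀ φ : LSet.Formula (Fin 1), IsSigmaFml k φ →
    ∀ (a : ZFSet) (ha : a.rank < κ),
      (φ.Realize (fun _ => a) ↔ φ.Realize (fun _ => (⟨a, ha⟩ : Vt κ)))

/-- A map preserves `Σₖ` formulas upwards and `Πₖ` formulas downwards. -/
def PreservesUp (k : ℕ) (α : Type) {A B : Type*} [LSet.Structure A] [LSet.Structure B]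
    (f : A → B) : Prop :=
  ∀ ⦃n : ℕ⦄ (φ : LSet.BoundedFormula α n) (v : α → A) (xs : Fin n → A),
    (IsSigmaFml k φ → φ.Realize v xs → φ.Realize (f ∘ v) (f ∘ xs)) ∧
    (IsPiFml k φ → φ.Realize (f ∘ v) (f ∘ xs) → φ.Realize v xs)

/-- A map preserves `Σₖ` formulas downwards and `Πₖ` formulas upwards. -/
def PreservesDown (k : ℕ) (α : Type) {A B : Type*} [LSet.Structure A] [LSet.Structure B]
    (f : A → B) : Prop :=
  ∀ ⦃n : ℕ⦄ (φ : LSet.BoundedFormula α n) (v : α → A) (xs : Fin n → A),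
    (IsSigmaFml k φ → φ.Realize (f ∘ v) (f ∘ xs) → φ.Realize v xs) ∧
    (IsPiFml k φ → φ.Realize v xs → φ.Realize (f ∘ v) (f ∘ xs))

/-- An embedding is an end embedding if its range is closed under elements. -/
def IsEndEmbedding {A B : Type*} [LSet.Structure A] [LSet.Structure B]
    (f : A ↪[LSet] B) : Prop :=
  ∀ (a : A) (b : B), Structure.RelMap adj ![b, f a] → ∃ a' : A, f a' = b

theorem realize_memBF {A : Type*} [LSet.Structure A] {α : Type} {n : ℕ}
    (t₁ t₂ : LSet.Term (α ⊕ Fin n)) (v : α → A) (xs : Fin n → A) :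
    (memBF t₁ t₂).Realize v xs ↔ Structure.RelMap adj
      ![t₁.realize (Sum.elim v xs), t₂.realize (Sum.elim v xs)] :=
  BoundedFormula.realize_rel₂

theorem realize_relabel_castSucc {A : Type*} [LSet.Structure A] {α : Type} {n : ℕ}
    (t : LSet.Term (α ⊕ Fin n)) (v : α → A) (xs : Fin n → A) (a : A) :
    (t.relabel (Sum.map id Fin.castSucc)).realize (Sum.elim v (Fin.snoc xs a : Fin (n + 1) → A)) =
      t.realize (Sum.elim v xs) := by
  rw [Term.realize_relabel, Sum.elim_comp_map, Function.comp_id]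
  congr 2
  exact funext fun i => Fin.snoc_castSucc (α := fun _ => A) a xs i

theorem IsDelta0.realize_endEmbedding {A B : Type*} [LSet.Structure A] [LSet.Structure B]
    {f : A ↪[LSet] B} (hf : IsEndEmbedding f) {α : Type} {n : ℕ}
    {φ : LSet.BoundedFormula α n} (h : IsDelta0 φ) (v : α → A) (xs : Fin n → A) :
    φ.Realize (f ∘ v) (f ∘ xs) ↔ φ.Realize v xs := by
  have term (α : Type) (n : ℕ) (t : LSet.Term (α ⊕ Fin n)) (v : α → A) (xs : Fin n → A) :
      t.realize (Sum.elim (f ∘ v) (f ∘ xs)) = f (t.realize (Sum.elim v xs)) := by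
    rw [← Sum.comp_elim]; exact HomClass.realize_term f
  have rel (a b : A) : Structure.RelMap adj ![f a, f b] ↔ Structure.RelMap adj ![a, b] := by
    rw [← StrongHomClass.map_rel f]
    congr! 1
    funext i; fin_cases i <;> rfl
  induction h with
  | of_isQF h => exact h.realize_embedding f
  | imp _ _ ih₁ ih₂ => simp only [BoundedFormula.realize_imp, ih₁, ih₂]
  | ball t _ ih =>
    simp only [BoundedFormula.realize_all, BoundedFormula.realize_imp, realize_memBF,
      realize_relabel_castSucc, Term.realize_var, Sum.elim_inr, Fin.snoc_last, term]
    constructor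
    · intro h a ha
      have := h (f a) ((rel _ _).2 ha)
      rw [← Fin.comp_snoc] at this
      exact (ih _).1 this
    · intro h b hb
      obtain ⟨a, rfl⟩ := hf _ _ hb
      rw [← Fin.comp_snoc]
      exact (ih _).2 (h a ((rel _ _).1 hb))
  | bex t _ ih =>
    simp only [BoundedFormula.realize_ex, BoundedFormula.realize_inf, realize_memBF,
      realize_relabel_castSucc, Term.realize_var, Sum.elim_inr, Fin.snoc_last, term]
    constructor
    · rintro ⟨b, hb, h⟩
      obtain ⟨a, rfl⟩ := hf _ _ hb
      rw [← Fin.comp_snoc] at h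
      exact ⟨a, (rel _ _).1 hb, (ih _).1 h⟩
    · rintro ⟨a, ha, h⟩
      refine ⟨f a, (rel _ _).2 ha, ?_⟩
      rw [← Fin.comp_snoc]
      exact (ih _).2 h

theorem IsSigmaFml.isDelta0 {α : Type} {n : ℕ} {φ : LSet.BoundedFormula α n}
    (h : IsSigmaFml 0 φ) : IsDelta0 φ := by
  cases h; assumption

theorem IsPiFml.isDelta0 {α : Type} {n : ℕ} {φ : LSet.BoundedFormula α n}
    (h : IsPiFml 0 φ) : IsDelta0 φ := by
  cases h; assumption

/-- Induction along the leading existential block of a `Σₖ₊₁` formula. -/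
theorem IsSigmaFml.induction {k : ℕ} {α : Type}
    {P : ∀ ⦃n : ℕ⦄, LSet.BoundedFormula α n → Prop}
    (base : ∀ ⦃n : ℕ⦄ (φ : LSet.BoundedFormula α n), IsPiFml k φ → P φ)
    (ex : ∀ ⦃n : ℕ⦄ (φ : LSet.BoundedFormula α (n + 1)), P φ → P φ.ex) :
    ∀ ⦃n : ℕ⦄ {φ : LSet.BoundedFormula α n}, IsSigmaFml (k + 1) φ → P φ
  | _, _, .of_delta0 h => base _ (.of_delta0 h)
  | _, _, .of_pi h => base _ h
  | _, _, .ex h => ex _ (IsSigmaFml.induction base ex h)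

/-- Induction along the leading universal block of a `Πₖ₊₁` formula. -/
theorem IsPiFml.induction {k : ℕ} {α : Type}
    {P : ∀ ⦃n : ℕ⦄, LSet.BoundedFormula α n → Prop}
    (base : ∀ ⦃n : ℕ⦄ (φ : LSet.BoundedFormula α n), IsSigmaFml k φ → P φ)
    (all : ∀ ⦃n : ℕ⦄ (φ : LSet.BoundedFormula α (n + 1)), P φ → P φ.all) :
    ∀ ⦃n : ℕ⦄ {φ : LSet.BoundedFormula α n}, IsPiFml (k + 1) φ → P φ
  | _, _, .of_delta0 h => base _ (.of_delta0 h)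
  | _, _, .of_sigma h => base _ h
  | _, _, .all h => all _ (IsPiFml.induction base all h)

theorem PreservesDown.preservesUp_succ {k : ℕ} {α : Type} {A B : Type*} [LSet.Structure A]
    [LSet.Structure B] {f : A → B} (h : PreservesDown k α f) : PreservesUp (k + 1) α f := by
  intro n φ v xs
  constructor
  · intro hφ
    refine IsSigmaFml.induction (P := fun n φ => ∀ xs : Fin n → A,
      φ.Realize v xs → φ.Realize (f ∘ v) (f ∘ xs)) (fun n φ hφ xs => (h φ v xs).2 hφ) ?_ hφ xs
    simp only [BoundedFormula.realize_ex]
    rintro n φ ih xs ⟨a, ha⟩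
    refine ⟨f a, ?_⟩
    rw [← Fin.comp_snoc]
    exact ih _ ha
  · intro hφ
    refine IsPiFml.induction (P := fun n φ => ∀ xs : Fin n → A,
      φ.Realize (f ∘ v) (f ∘ xs) → φ.Realize v xs) (fun n φ hφ xs => (h φ v xs).1 hφ) ?_ hφ xs
    simp only [BoundedFormula.realize_all]
    intro n φ ih xs H a
    apply ih
    rw [Fin.comp_snoc]
    exact H _

theorem IsEndEmbedding.preservesUp_one {A B : Type*} [LSet.Structure A] [LSet.Structure B]
    {f : A ↪[LSet] B} (hf : IsEndEmbedding f) (α : Type) : PreservesUp 1 α f :=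
  PreservesDown.preservesUp_succ fun _ _ _ _ =>
    ⟨fun h => (h.isDelta0.realize_endEmbedding hf _ _).1,
      fun h => (h.isDelta0.realize_endEmbedding hf _ _).2⟩

/-- An injective map which preserves and reflects membership is an embedding. -/
def embeddingOfMem {A B : Type*} [LSet.Structure A] [LSet.Structure B] (f : A → B)
    (hf : Function.Injective f)
    (hmem : ∀ a b : A, Structure.RelMap (L := LSet) adj ![f a, f b] ↔
      Structure.RelMap (L := LSet) adj ![a, b]) : A ↪[LSet] B where
  toFun := f
  inj' := hf
  map_fun' := fun g _ => g.elim
  map_rel' := by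
    rintro n ⟨⟩ x
    have hx : x = ![x 0, x 1] := by funext i; fin_cases i <;> rfl
    have hfx : f ∘ x = ![f (x 0), f (x 1)] := by funext i; fin_cases i <;> rfl
    rw [hfx]
    nth_rw 3 [hx]
    exact hmem _ _

/-- The inclusion of `V_γ` into the universe. -/
def inclusion (γ : Ordinal) : Vt γ ↪[LSet] ZFSet :=
  embeddingOfMem Subtype.val Subtype.val_injective fun _ _ => Iff.rfl

theorem isEndEmbedding_inclusion (γ : Ordinal) : IsEndEmbedding (inclusion γ) :=
  fun a b h => ⟨⟨b, (ZFSet.rank_lt_of_mem h).trans a.2⟩, rfl⟩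

/-- The Mostowski collapse of the membership relation restricted to `M`. -/
noncomputable def collapse (M : Set ZFSet.{0}) (x : ZFSet.{0}) : ZFSet.{0} :=
  ZFSet.range fun y : {y : Shrink.{0} x // ((equivShrink x).symm y : ZFSet) ∈ M} =>
    collapse M ((equivShrink x).symm y.1 : ZFSet)
termination_by x
decreasing_by exact ((equivShrink x).symm y.1).2

theorem mem_collapse {M : Set ZFSet.{0}} {x z : ZFSet.{0}} :
    z ∈ collapse M x ↔ ∃ y ∈ M, y ∈ x ∧ collapse M y = z := by
  rw [collapse, ZFSet.mem_range]
  constructor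
  · rintro ⟨⟨y, hy⟩, rfl⟩
    exact ⟨_, hy, ((equivShrink x).symm y).2, rfl⟩
  · rintro ⟨y, hM, hx, rfl⟩
    refine ⟨⟨equivShrink x ⟨y, hx⟩, ?_⟩, ?_⟩ <;> simp [hM]

theorem collapse_eq_self {M : Set ZFSet.{0}} {t : ZFSet.{0}} (ht : t.IsTransitive)
    (htM : ∀ x ∈ t, x ∈ M) (x : ZFSet.{0}) : x ∈ t → collapse M x = x := by
  induction x using ZFSet.inductionOn with
  | h x ih =>
    intro hx
    ext z
    rw [mem_collapse]
    constructor
    · rintro ⟨y, -, hy, rfl⟩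
      rwa [ih y hy (ht.mem_trans hy hx)]
    · intro hz
      exact ⟨z, htM z (ht.mem_trans hz hx), hz, ih z hz (ht.mem_trans hz hx)⟩

theorem collapse_injOn {M : Set ZFSet.{0}}
    (hM : ∀ x ∈ M, ∀ y ∈ M, (∀ z ∈ M, z ∈ x ↔ z ∈ y) → x = y) :
    Set.InjOn (collapse M) M := by
  intro x
  induction x using ZFSet.inductionOn with
  | h x ih =>
    intro hx y hy hxy
    refine hM x hx y hy fun z hz => ⟨fun hzx => ?_, fun hzy => ?_⟩
    · have : collapse M z ∈ collapse M y := hxy ▸ mem_collapse.2 ⟨z, hz, hzx, rfl⟩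
      obtain ⟨w, hw, hwy, hwz⟩ := mem_collapse.1 this
      rwa [ih z hzx hz hw hwz.symm]
    · have : collapse M z ∈ collapse M x := hxy ▸ mem_collapse.2 ⟨z, hz, hzy, rfl⟩
      obtain ⟨w, hw, hwx, hwz⟩ := mem_collapse.1 this
      rwa [← ih w hwx hw hz hwz]

theorem rank_collapse_lt {M : Set ZFSet.{0}} {c : Cardinal.{0}} (hc : c.IsRegular)
    (hM : Cardinal.mk M < Cardinal.lift.{1} c) (x : ZFSet.{0}) :
    (collapse M x).rank < c.ord := by
  induction x using ZFSet.inductionOn with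
  | h x ih =>
    rw [collapse, ZFSet.rank_range]
    refine Ordinal.lift_iSup_add_one_lt_of_lt_cof ?_ fun y => ih _ ((equivShrink x).symm y.1).2
    rw [Ordinal.lift_id, hc.cof_ord, Cardinal.lift_id, ← Cardinal.lift_lt.{0, 1}]
    refine lt_of_le_of_lt ?_ hM
    rw [← Cardinal.lift_id'.{0, 1} (Cardinal.mk M)]
    refine Cardinal.lift_mk_le'.2 ⟨⟨fun y => ⟨_, y.2⟩, fun y z h => ?_⟩⟩
    simpa [Subtype.ext_iff] using h

/-- Elementary substructures of the universe are extensional. -/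
theorem elementarySubstructure_ext (S : LSet.ElementarySubstructure ZFSet.{0})
    {x y : ZFSet.{0}} (hx : x ∈ S) (hy : y ∈ S) (h : ∀ z ∈ S, z ∈ x ↔ z ∈ y) : x = y := by
  let φ : LSet.BoundedFormula (Fin 2) 0 :=
    (((memBF (Term.var (Sum.inr 0)) (Term.var (Sum.inl 0))).iff
      (memBF (Term.var (Sum.inr 0)) (Term.var (Sum.inl 1))) : LSet.BoundedFormula (Fin 2) 1)).all
  have key := S.subtype.map_boundedFormula φ ![⟨x, hx⟩, ⟨y, hy⟩] default
  simp only [φ, BoundedFormula.realize_all, BoundedFormula.realize_iff, realize_memBF] at key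
  ext z
  exact key.2 (fun z => h z.1 z.2) z

/-- The collapse of a small elementary substructure of the universe embeds into `V_γ`. -/
theorem exists_collapse {γ β : Ordinal.{0}} (hγ : IsInaccOrd γ) (hβ : β < γ)
    (hω : Ordinal.omega0 ≤ β) :
    ∃ (S : LSet.ElementarySubstructure ZFSet.{0}) (g : S ↪[LSet] Vt γ), IsEndEmbedding g ∧
      ∀ x : ZFSet, x.rank < β → ∃ y : S, (y : ZFSet) = x ∧ (g y : ZFSet) = x := by
  have hcard : Cardinal.mk (ZFSet.vonNeumann β) < Cardinal.lift.{1} γ.card := by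
    rw [ZFSet.cardinalMk_coe_sort, Cardinal.lift_lt, ZFSet.card_vonNeumann,
      ← hγ.1.preBeth_ord, hγ.2]
    exact Cardinal.preBeth_strictMono hβ
  have hinf : Cardinal.aleph0 ≤ Cardinal.mk (ZFSet.vonNeumann β) := by
    rw [ZFSet.cardinalMk_coe_sort, Cardinal.aleph0_le_lift]
    refine le_trans ?_ (Ordinal.card_le_card_vonNeumann β)
    simpa using Ordinal.card_le_card hω
  obtain ⟨S, hS, hScard⟩ := exists_elementarySubstructure_card_eq LSet
    {x | x ∈ ZFSet.vonNeumann β} (Cardinal.mk (ZFSet.vonNeumann β)) hinf le_rfl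
    (by
      refine le_trans ?_ (Cardinal.aleph0_le_lift.2 hinf)
      rw [Cardinal.lift_le_aleph0]
      exact Cardinal.mk_le_aleph0 (α := LSet.Symbols))
    (Cardinal.lift_le.2 (Cardinal.mk_subtype_le _))
  have hSlt : Cardinal.mk (S : Set ZFSet.{0}) < Cardinal.lift.{1} γ.card := by
    rw [Cardinal.lift_id, Cardinal.lift_id] at hScard
    exact hScard.trans_lt hcard
  have hinj := collapse_injOn (M := (S : Set ZFSet.{0})) fun x hx y hy =>
    elementarySubstructure_ext S hx hy
  have hrank (x : ZFSet.{0}) : (collapse S x).rank < γ := by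
    have := rank_collapse_lt hγ.1.isRegular hSlt x
    rwa [hγ.2] at this
  refine ⟨S, embeddingOfMem (fun x => ⟨collapse S x, hrank x⟩)
    (fun x y h => Subtype.ext (hinj x.2 y.2 (congrArg Subtype.val h))) ?_, ?_, ?_⟩
  · intro x y
    change collapse S x ∈ collapse S y ↔ (x : ZFSet) ∈ (y : ZFSet)
    rw [mem_collapse]
    constructor
    · rintro ⟨z, hz, hzy, h⟩
      rwa [← hinj hz x.2 h]
    · exact fun h => ⟨x, x.2, h, rfl⟩
  · intro x b h
    obtain ⟨z, hz, -, h⟩ := mem_collapse.1 h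
    exact ⟨⟨z, hz⟩, Subtype.ext h⟩
  · intro x hx
    have hx := ZFSet.mem_vonNeumann.2 hx
    exact ⟨⟨x, hS hx⟩, rfl,
      collapse_eq_self (ZFSet.isTransitive_vonNeumann β) (fun y hy => hS hy) x hx⟩

theorem IsInaccOrd.omega0_lt {γ : Ordinal} (hγ : IsInaccOrd γ) : Ordinal.omega0 < γ := by
  rw [← hγ.2, ← Cardinal.ord_aleph0, Cardinal.ord_lt_ord]
  exact hγ.1.aleph0_lt

/-- Lévy: `V_γ` is a `Σ₁`-elementary substructure of the universe for inaccessible `γ`. -/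
theorem preservesDown_one_inclusion {γ : Ordinal} (hγ : IsInaccOrd γ) (α : Type) [Finite α] :
    PreservesDown 1 α (inclusion γ) := by
  intro n φ v xs
  have hlim : Order.IsSuccLimit γ := by
    rw [← hγ.2]; exact Cardinal.isSuccLimit_ord hγ.1.aleph0_lt.le
  obtain ⟨β, hβ, hω, hrank⟩ : ∃ β < γ, Ordinal.omega0 ≤ β ∧
      ∀ i : α ⊕ Fin n, (Sum.elim v xs i).1.rank < β := by
    have : Nonempty (Set.Iio γ) := ⟨⟨Ordinal.omega0, hγ.omega0_lt⟩⟩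
    obtain ⟨δ, hδ⟩ := Finite.exists_le
      (fun i : α ⊕ Fin n => (⟨_, (Sum.elim v xs i).2⟩ : Set.Iio γ))
    refine ⟨max Ordinal.omega0 (Order.succ δ), max_lt hγ.omega0_lt (hlim.succ_lt δ.2),
      le_max_left _ _, fun i => lt_max_of_lt_right (Order.lt_succ_of_le (hδ i))⟩
  obtain ⟨S, g, hg, hS⟩ := exists_collapse hγ hβ hω
  choose! r hr hgr using hS
  have hv : ∃ v' : α → S, S.subtype ∘ v' = inclusion γ ∘ v ∧ g ∘ v' = v :=
    ⟨fun i => r (v i), funext fun i => hr _ (hrank (.inl i)),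
      funext fun i => Subtype.ext (hgr _ (hrank (.inl i)))⟩
  have hxs : ∃ xs' : Fin n → S, S.subtype ∘ xs' = inclusion γ ∘ xs ∧ g ∘ xs' = xs :=
    ⟨fun i => r (xs i), funext fun i => hr _ (hrank (.inr i)),
      funext fun i => Subtype.ext (hgr _ (hrank (.inr i)))⟩
  obtain ⟨v', hv', hgv⟩ := hv
  obtain ⟨xs', hxs', hgxs⟩ := hxs
  have hup := hg.preservesUp_one α φ v' xs'
  rw [hgv, hgxs] at hup
  rw [← hv', ← hxs', S.subtype.map_boundedFormula]
  exact hup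

theorem preservesUp_two_inclusion {γ : Ordinal} (hγ : IsInaccOrd γ) (α : Type) [Finite α] :
    PreservesUp 2 α (inclusion γ) :=
  (preservesDown_one_inclusion hγ α).preservesUp_succ

/-- A `Σₖ₊₁` formula true in the universe is true in `V_γ` for all large inaccessible `γ`. -/
theorem IsSigmaFml.exists_forall_realize {k : ℕ} {α : Type}
    (hk : ∀ γ, IsInaccOrd γ → PreservesUp k α (inclusion γ)) {n : ℕ}
    {φ : LSet.BoundedFormula α n} (hφ : IsSigmaFml (k + 1) φ) (v : α → ZFSet) (xs : Fin n → ZFSet)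
    (h : φ.Realize v xs) :
    ∃ θ : Ordinal, ∀ γ, IsInaccOrd γ → θ ≤ γ → ∀ (v' : α → Vt γ) (xs' : Fin n → Vt γ),
      inclusion γ ∘ v' = v → inclusion γ ∘ xs' = xs → φ.Realize v' xs' := by
  refine IsSigmaFml.induction (P := fun n φ => ∀ xs : Fin n → ZFSet, φ.Realize v xs →
    ∃ θ : Ordinal, ∀ γ, IsInaccOrd γ → θ ≤ γ → ∀ (v' : α → Vt γ) (xs' : Fin n → Vt γ),
      inclusion γ ∘ v' = v → inclusion γ ∘ xs' = xs → φ.Realize v' xs') ?_ ?_ hφ xs h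
  · rintro n φ hφ _ h
    refine ⟨0, ?_⟩
    rintro γ hγ - v' xs' rfl rfl
    exact (hk γ hγ φ v' xs').2 hφ h
  · intro n φ ih xs h
    obtain ⟨a, ha⟩ := BoundedFormula.realize_ex.1 h
    obtain ⟨θ, hθ⟩ := ih _ ha
    refine ⟨max θ (Order.succ a.rank), ?_⟩
    rintro γ hγ hle v' xs' hv rfl
    refine BoundedFormula.realize_ex.2
      ⟨⟨a, Order.succ_le_iff.1 ((le_max_right _ _).trans hle)⟩,
        hθ γ hγ ((le_max_left _ _).trans hle) v' _ hv ?_⟩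
    rw [Fin.comp_snoc]
    rfl

/-- A `Πₖ₊₁` formula false in the universe is false in `V_γ` for all large inaccessible `γ`. -/
theorem IsPiFml.exists_forall_not_realize {k : ℕ} {α : Type}
    (hk : ∀ γ, IsInaccOrd γ → PreservesUp k α (inclusion γ)) {n : ℕ}
    {φ : LSet.BoundedFormula α n} (hφ : IsPiFml (k + 1) φ) (v : α → ZFSet) (xs : Fin n → ZFSet)
    (h : ¬ φ.Realize v xs) :
    ∃ θ : Ordinal, ∀ γ, IsInaccOrd γ → θ ≤ γ → ∀ (v' : α → Vt γ) (xs' : Fin n → Vt γ),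
      inclusion γ ∘ v' = v → inclusion γ ∘ xs' = xs → ¬ φ.Realize v' xs' := by
  refine IsPiFml.induction (P := fun n φ => ∀ xs : Fin n → ZFSet, ¬ φ.Realize v xs →
    ∃ θ : Ordinal, ∀ γ, IsInaccOrd γ → θ ≤ γ → ∀ (v' : α → Vt γ) (xs' : Fin n → Vt γ),
      inclusion γ ∘ v' = v → inclusion γ ∘ xs' = xs → ¬ φ.Realize v' xs') ?_ ?_ hφ xs h
  · rintro n φ hφ _ h
    refine ⟨0, ?_⟩
    rintro γ hγ - v' xs' rfl rfl
    exact mt ((hk γ hγ φ v' xs').1 hφ) h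
  · intro n φ ih xs h
    obtain ⟨a, ha⟩ := not_forall.1 (mt BoundedFormula.realize_all.2 h)
    obtain ⟨θ, hθ⟩ := ih _ ha
    refine ⟨max θ (Order.succ a.rank), ?_⟩
    rintro γ hγ hle v' xs' hv rfl h'
    refine hθ γ hγ ((le_max_left _ _).trans hle) v' _ hv ?_ (BoundedFormula.realize_all.1 h'
      ⟨a, Order.succ_le_iff.1 ((le_max_right _ _).trans hle)⟩)
    rw [Fin.comp_snoc]
    rfl

theorem IsUplifting.preservesDown_succ {κ : Ordinal} (h : IsUplifting κ) {k : ℕ} {α : Type}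
    (hk : ∀ γ, IsInaccOrd γ → PreservesUp k α (inclusion γ)) :
    PreservesDown (k + 1) α (inclusion κ) := by
  intro n φ v xs
  have reflect (θ : Ordinal) : ∃ γ, IsInaccOrd γ ∧ θ ≤ γ ∧ ∃ (v' : α → Vt γ) (xs' : Fin n → Vt γ),
      inclusion γ ∘ v' = inclusion κ ∘ v ∧ inclusion γ ∘ xs' = inclusion κ ∘ xs ∧
      (φ.Realize v' xs' ↔ φ.Realize v xs) := by
    obtain ⟨γ, hγ, hθ, -, e, he⟩ := h.2 θ
    exact ⟨γ, hγ, hθ, e ∘ v, e ∘ xs, funext fun _ => he _, funext fun _ => he _,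
      e.map_boundedFormula φ v xs⟩
  constructor
  · intro hφ h
    obtain ⟨θ, hθ⟩ := hφ.exists_forall_realize hk _ _ h
    obtain ⟨γ, hγ, hle, v', xs', hv, hxs, hiff⟩ := reflect θ
    exact hiff.1 (hθ γ hγ hle v' xs' hv hxs)
  · intro hφ h
    by_contra hn
    obtain ⟨θ, hθ⟩ := hφ.exists_forall_not_realize hk _ _ hn
    obtain ⟨γ, hγ, hle, v', xs', hv, hxs, hiff⟩ := reflect θ
    exact hθ γ hγ hle v' xs' hv hxs (hiff.2 h)

/-- Every uplifting cardinal is Σ₃-reflecting. -/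
theorem uplifting_sigma3_reflecting (κ : Ordinal) (h : IsUplifting κ) :
    SigmaReflecting 3 κ := by
  refine ⟨h.1, fun φ hφ a ha => ?_⟩
  have hdown₂ : PreservesDown 2 (Fin 1) (inclusion κ) :=
    h.preservesDown_succ fun γ _ => (isEndEmbedding_inclusion γ).preservesUp_one _
  have hdown₃ : PreservesDown 3 (Fin 1) (inclusion κ) :=
    h.preservesDown_succ fun γ hγ => preservesUp_two_inclusion hγ _
  constructor
  · intro H
    refine (hdown₃ φ (fun _ => ⟨a, ha⟩) default).1 hφ ?_
    rw [Unique.eq_default (inclusion κ ∘ default)]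
    exact H
  · intro H
    have := (hdown₂.preservesUp_succ φ (fun _ => ⟨a, ha⟩) default).1 hφ H
    rw [Unique.eq_default (inclusion κ ∘ default)] at this
    exact this

end Paper
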